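/- Let c and c' be s-adjacent chambers in the same half C_ε for some s ∈ S. If ℓ^θ(c) = ℓ^θ(c'), then δ^θ(c) = δ^θ(c'). -/

import Mathlib

universe u v

/-- A twin building of type `(W,S)` (where `S` is the set of simple reflections of the
Coxeter system `cs`), with positive half `Cp` and negative half `Cm`, distance functions
`δp`, `δm`, codistance `δst : Cp × Cm → W`, `δts : Cm × Cp → W`, together with a
quasi-flip: maps `θp : Cp → Cm`, `θm : Cm → Cp` inverse to each other and an automorphism
`π` of `W` with `π(S) = S`, `π ∘ π = id`, compatible with the distances and the
codistance. -/
structure QuasiFlipTwinBuilding {B : Type*} {W : Type*} [Group W]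
    (M : CoxeterMatrix B) (cs : CoxeterSystem M W)
    (Cp : Type u) (Cm : Type v) where
  δp : Cp → Cp → W
  δm : Cm → Cm → W
  δst : Cp → Cm → W
  δts : Cm → Cp → W
  θp : Cp → Cm
  θm : Cm → Cp
  π : W ≃* W
  nonempty_p : Nonempty Cp
  nonempty_m : Nonempty Cm
  /-- (Bu1) for the positive half -/
  p_eq_one_iff : ∀ x y : Cp, δp x y = 1 ↔ x = y
  /-- (Bu1) for the negative half -/
  m_eq_one_iff : ∀ x y : Cm, δm x y = 1 ↔ x = y
  /-- (Bu2) for the positive half -/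
  p_two : ∀ (x y z : Cp) (s : W), s ∈ Set.range cs.simple → δp y z = s →
    δp x z = δp x y ∨ δp x z = δp x y * s
  p_two' : ∀ (x y z : Cp) (s : W), s ∈ Set.range cs.simple → δp y z = s →
    cs.length (δp x y * s) = cs.length (δp x y) + 1 → δp x z = δp x y * s
  /-- (Bu2) for the negative half -/
  m_two : ∀ (x y z : Cm) (s : W), s ∈ Set.range cs.simple → δm y z = s →
    δm x z = δm x y ∨ δm x z = δm x y * s
  m_two' : ∀ (x y z : Cm) (s : W), s ∈ Set.range cs.simple → δm y z = s →
    cs.length (δm x y * s) = cs.length (δm x y) + 1 → δm x z = δm x y * s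
  /-- (Bu3) for the positive half -/
  p_three : ∀ (x y : Cp) (s : W), s ∈ Set.range cs.simple →
    ∃ z : Cp, δp y z = s ∧ δp x z = δp x y * s
  /-- (Bu3) for the negative half -/
  m_three : ∀ (x y : Cm) (s : W), s ∈ Set.range cs.simple →
    ∃ z : Cm, δm y z = s ∧ δm x z = δm x y * s
  /-- (Tw1) -/
  tw1 : ∀ (x : Cp) (y : Cm), δts y x = (δst x y)⁻¹
  /-- (Tw2), positive-to-negative -/
  tw2p : ∀ (x : Cp) (y z : Cm) (s : W), s ∈ Set.range cs.simple → δm y z = s →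
    cs.length (δst x y * s) + 1 = cs.length (δst x y) → δst x z = δst x y * s
  /-- (Tw2), negative-to-positive -/
  tw2m : ∀ (x : Cm) (y z : Cp) (s : W), s ∈ Set.range cs.simple → δp y z = s →
    cs.length (δts x y * s) + 1 = cs.length (δts x y) → δts x z = δts x y * s
  /-- (Tw3), positive-to-negative -/
  tw3p : ∀ (x : Cp) (y : Cm) (s : W), s ∈ Set.range cs.simple →
    ∃ z : Cm, δm y z = s ∧ δst x z = δst x y * s
  /-- (Tw3), negative-to-positive -/
  tw3m : ∀ (x : Cm) (y : Cp) (s : W), s ∈ Set.range cs.simple →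
    ∃ z : Cp, δp y z = s ∧ δts x z = δts x y * s
  /-- `θ ∘ θ = id` -/
  θmθp : ∀ c : Cp, θm (θp c) = c
  θpθm : ∀ c : Cm, θp (θm c) = c
  /-- `π(S) = S` -/
  πS : ⇑π '' Set.range cs.simple = Set.range cs.simple
  /-- `π ∘ π = id` -/
  ππ : ∀ w : W, π (π w) = w
  /-- `θ` interchanges the distances via `π` -/
  flip_p : ∀ x y : Cp, δm (θp x) (θp y) = π (δp x y)
  flip_m : ∀ x y : Cm, δp (θm x) (θm y) = π (δm x y)
  /-- `θ` preserves the codistance via `π` -/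
  flip_st : ∀ (x : Cp) (z : Cm), δts (θp x) (θm z) = π (δst x z)
  flip_ts : ∀ (x : Cm) (z : Cp), δst (θm x) (θp z) = π (δts x z)

namespace QuasiFlipTwinBuilding

variable {B : Type*} {W : Type*} [Group W] {M : CoxeterMatrix B} {cs : CoxeterSystem M W}
  {Cp : Type u} {Cm : Type v}

/-- The same twin building with a quasi-flip, with the roles of the two halves
interchanged. -/
def swap (T : QuasiFlipTwinBuilding M cs Cp Cm) : QuasiFlipTwinBuilding M cs Cm Cp where
  δp := T.δm
  δm := T.δp
  δst := T.δts
  δts := T.δst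
  θp := T.θm
  θm := T.θp
  π := T.π
  nonempty_p := T.nonempty_m
  nonempty_m := T.nonempty_p
  p_eq_one_iff := T.m_eq_one_iff
  m_eq_one_iff := T.p_eq_one_iff
  p_two := T.m_two
  p_two' := T.m_two'
  m_two := T.p_two
  m_two' := T.p_two'
  p_three := T.m_three
  m_three := T.p_three
  tw1 := fun x y => by rw [T.tw1 y x, inv_inv]
  tw2p := T.tw2m
  tw2m := T.tw2p
  tw3p := T.tw3m
  tw3m := T.tw3p
  θmθp := T.θpθm
  θpθm := T.θmθp
  πS := T.πS
  ππ := T.ππ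
  flip_p := T.flip_m
  flip_m := T.flip_p
  flip_st := T.flip_ts
  flip_ts := T.flip_st

variable (T : QuasiFlipTwinBuilding M cs Cp Cm)

/-- The `θ`-codistance `δ^θ(c) = δ*(c, θ(c))` of a chamber of the positive half. -/
def δθ (c : Cp) : W := T.δst c (T.θp c)

/-- The numerical `θ`-codistance `ℓ^θ(c) = ℓ(δ^θ(c))`. -/
noncomputable def ℓθ (c : Cp) : ℕ := cs.length (T.δθ c)

/-- The `s`-panel of a chamber `c`. -/
def panel (s : W) (c : Cp) : Set Cp := {d | T.δp c d = 1 ∨ T.δp c d = s}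

/-- The `J`-residue of a chamber `c`. -/
def residue (J : Set W) (c : Cp) : Set Cp := {d | T.δp c d ∈ Subgroup.closure J}

/-- Opposition of chambers: `δ*(c,d) = 1`. -/
def Opp (c : Cp) (d : Cm) : Prop := T.δst c d = 1

/-- `R` is a Phan residue of type `J`: `R` is a `J`-residue, every chamber of `R` is
opposite some chamber of `θ(R)`, and every chamber of `θ(R)` is opposite some chamber
of `R`. -/
def IsPhan (J : Set W) (R : Set Cp) : Prop :=
  (∃ c : Cp, R = T.residue J c) ∧
  (∀ r ∈ R, ∃ r' ∈ R, T.Opp r (T.θp r')) ∧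
  (∀ r' ∈ R, ∃ r ∈ R, T.Opp r (T.θp r'))

/-- `R` is a minimal Phan residue of type `J`: it is a Phan residue containing no Phan
residue as a proper subset. -/
def IsMinPhan (J : Set W) (R : Set Cp) : Prop :=
  T.IsPhan J R ∧ ∀ (J' : Set W) (R' : Set Cp), J' ⊆ Set.range cs.simple →
    T.IsPhan J' R' → R' ⊆ R → R' = R

/-- Two chambers are `J`-adjacent: they are `j`-adjacent for some `j ∈ J`. -/
def adjJ (J : Set W) (c d : Cp) : Prop := ∃ j ∈ J, T.δp c d = 1 ∨ T.δp c d = j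

/-- There is a `J`-gallery from `c` to `d` all of whose chambers lie in `X`. -/
def GalleryIn (X : Set Cp) (J : Set W) (c d : Cp) : Prop :=
  ∃ γ : List Cp, γ.head? = some c ∧ γ.getLast? = some d ∧
    γ.Chain' (T.adjJ J) ∧ ∀ x ∈ γ, x ∈ X

/-- The flip-flop system of a set `R` of chambers: the chambers of `R` whose numerical
`θ`-codistance is minimal among chambers of `R`. -/
def flipflop (R : Set Cp) : Set Cp := {c ∈ R | ∀ d ∈ R, T.ℓθ c ≤ T.ℓθ d}

/-- The flip-flop system `R^θ` is connected: any two of its chambers are joined by a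
gallery all of whose chambers lie in `R^θ`. -/
def ConnectedFF (R : Set Cp) : Prop :=
  ∀ c ∈ T.flipflop R, ∀ d ∈ T.flipflop R,
    T.GalleryIn (T.flipflop R) (Set.range cs.simple) c d

/-- `R` admits direct descent into `R^θ`: from every chamber of `R` there is a gallery
within `R` ending in `R^θ` along which the numerical `θ`-codistance strictly decreases. -/
def DirectDescent (R : Set Cp) : Prop :=
  ∀ c ∈ R, ∃ γ : List Cp, γ.head? = some c ∧
    (∃ e, γ.getLast? = some e ∧ e ∈ T.flipflop R) ∧
    γ.Chain' (T.adjJ (Set.range cs.simple)) ∧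
    γ.Chain' (fun a b => T.ℓθ b < T.ℓθ a) ∧
    ∀ x ∈ γ, x ∈ R

/-- The quasi-flip is strong on this half: for every chamber `c` and every `s ∈ S` there
are chambers `d, x` in the `s`-panel of `c` with `ℓ(δ*(x, θ(d))) > ℓ(δ*(d, θ(d)))`,
i.e. the projection of `θ(d)` onto the panel is not `d`. -/
def IsStrongHalf : Prop :=
  ∀ (c : Cp) (s : W), s ∈ Set.range cs.simple →
    ∃ d ∈ T.panel s c, ∃ x ∈ T.panel s c,
      cs.length (T.δst d (T.θp d)) < cs.length (T.δst x (T.θp d))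

end QuasiFlipTwinBuilding

theorem Function.End.mul_apply {α : Type*} (f g : Function.End α) (a : α) :
    (f * g) a = f (g a) := rfl

theorem Function.End.one_apply {α : Type*} (a : α) : (1 : Function.End α) a = a := rfl

namespace CoxeterSystem

variable {B : Type*} {W : Type*} [Group W] {M : CoxeterMatrix B} (cs : CoxeterSystem M W)

open Classical in
/-- The action of the simple reflection `s i` on `W × ZMod 2`: conjugation on the first
component, with a change of sign at `s i` itself. -/
noncomputable def signedConj (i : B) : Function.End (W × ZMod 2) := fun p =>
  (cs.simple i * p.1 * cs.simple i, p.2 + if p.1 = cs.simple i then 1 else 0)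

open Classical in
theorem signedConj_mul_pow_apply (i j : B) (n : ℕ) (t : W) (e : ZMod 2) :
    ((cs.signedConj i * cs.signedConj j) ^ n) (t, e) =
      ((cs.simple i * cs.simple j) ^ n * t * ((cs.simple i * cs.simple j) ^ n)⁻¹,
        e + ∑ m ∈ Finset.range (2 * n),
          if (cs.simple i * cs.simple j) ^ m * t = cs.simple j then 1 else 0) := by
  set r := cs.simple i * cs.simple j with hr
  have hrj : r * cs.simple j = cs.simple i := by simp [hr]
  have hjr : cs.simple j * r⁻¹ = cs.simple i := by simp [hr]
  have hcomm (n : ℕ) : cs.simple j * (r ^ n)⁻¹ = r ^ n * cs.simple j := by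
    induction n with
    | zero => simp
    | succ n ih =>
      calc cs.simple j * (r ^ (n + 1))⁻¹ = cs.simple j * (r ^ n)⁻¹ * r⁻¹ := by
            rw [pow_succ', mul_inv_rev, mul_assoc]
        _ = r ^ n * (cs.simple j * r⁻¹) := by rw [ih, mul_assoc]
        _ = r ^ (n + 1) * cs.simple j := by rw [hjr, ← hrj, pow_succ, mul_assoc (r ^ n)]
  have hconj (n k : ℕ) : r ^ n * t * (r ^ n)⁻¹ = (r ^ k)⁻¹ * cs.simple j ↔
      r ^ (2 * n + k) * t = cs.simple j := by
    have h : (r ^ n)⁻¹ * ((r ^ k)⁻¹ * cs.simple j) * r ^ n =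
        (r ^ (2 * n + k))⁻¹ * cs.simple j := by
      have : cs.simple j * r ^ n = (r ^ n)⁻¹ * cs.simple j := by
        rw [eq_inv_mul_iff_mul_eq, ← mul_assoc, ← hcomm, inv_mul_cancel_right]
      rw [mul_assoc, mul_assoc, this]
      simp only [← mul_assoc, ← mul_inv_rev, ← pow_add]
      rw [show n + k + n = 2 * n + k by ring]
    rw [← eq_inv_mul_iff_mul_eq (b := r ^ (2 * n + k)), ← h, mul_inv_eq_iff_eq_mul,
      mul_assoc (r ^ n)⁻¹, eq_inv_mul_iff_mul_eq (b := r ^ n)]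
  have hconj' (n : ℕ) : cs.simple j * (r ^ n * t * (r ^ n)⁻¹) * cs.simple j = cs.simple i ↔
      r ^ (2 * n + 1) * t = cs.simple j := by
    have h₁ : cs.simple j * (r ^ n * t * (r ^ n)⁻¹) * cs.simple j = cs.simple i ↔
        r ^ n * t * (r ^ n)⁻¹ = r⁻¹ * cs.simple j := by
      constructor
      · intro h
        have : cs.simple j * (cs.simple j * (r ^ n * t * (r ^ n)⁻¹) * cs.simple j) * cs.simple j =
          cs.simple j * cs.simple i * cs.simple j := by rw [h]
        simpa [mul_assoc, hr] using this
      · intro h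
        rw [h]
        simp [hr, mul_assoc]
    rw [h₁, ← hconj n 1, pow_one]
  induction n with
  | zero => simp [Function.End.one_apply]
  | succ n ih =>
    rw [pow_succ', Function.End.mul_apply, ih, Function.End.mul_apply]
    ext
    · simp [signedConj, pow_succ', hr, mul_assoc]
    · have h := hconj n 0
      simp only [pow_zero, inv_one, one_mul, add_zero] at h
      simp only [signedConj, h, hconj']
      rw [show 2 * (n + 1) = 2 * n + 1 + 1 by ring, Finset.sum_range_succ, Finset.sum_range_succ]
      simp only [add_assoc]

theorem isLiftable_signedConj : M.IsLiftable cs.signedConj := by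
  classical
  intro i j
  funext ⟨t, e⟩
  rw [signedConj_mul_pow_apply, cs.simple_mul_simple_pow, two_mul, Finset.sum_range_add]
  simp [pow_add, CharTwo.add_self_eq_zero, Function.End.one_apply]

/-- The parity of the number of occurrences of `t` in the right inversion sequence of a word
representing `w`. -/
noncomputable def inversionParity (w t : W) : ZMod 2 :=
  (cs.lift ⟨cs.signedConj, cs.isLiftable_signedConj⟩ w (t, 0)).2

theorem lift_signedConj_apply (w t : W) (e : ZMod 2) :
    cs.lift ⟨cs.signedConj, cs.isLiftable_signedConj⟩ w (t, e) =
      (w * t * w⁻¹, e + cs.inversionParity w t) := by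
  unfold inversionParity
  induction w using cs.simple_induction_left generalizing t e with
  | one => simp [Function.End.one_apply]
  | mul_simple_left w i ih =>
    rw [map_mul, lift_apply_simple, Function.End.mul_apply, Function.End.mul_apply, ih t e, ih t 0]
    simp [signedConj, mul_assoc, add_assoc]

open Classical in
theorem inversionParity_simple_mul (w t : W) (i : B) :
    cs.inversionParity (cs.simple i * w) t =
      cs.inversionParity w t + if w * t * w⁻¹ = cs.simple i then 1 else 0 := by
  rw [inversionParity, map_mul, lift_apply_simple, Function.End.mul_apply,
    lift_signedConj_apply]
  simp [signedConj]

theorem inversionParity_mul_simple (w : W) (i : B) :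
    cs.inversionParity (w * cs.simple i) (cs.simple i) =
      1 + cs.inversionParity w (cs.simple i) := by
  rw [inversionParity, map_mul, lift_apply_simple, Function.End.mul_apply]
  simp [signedConj, lift_signedConj_apply]

theorem mem_rightInvSeq_of_inversionParity_ne_zero (ω : List B) (t : W)
    (h : cs.inversionParity (cs.wordProd ω) t ≠ 0) : t ∈ cs.rightInvSeq ω := by
  induction ω with
  | nil => simp [inversionParity, Function.End.one_apply] at h
  | cons i ω ih =>
    rw [wordProd_cons, inversionParity_simple_mul] at h
    rw [rightInvSeq, List.mem_cons]
    by_cases ht : cs.wordProd ω * t * (cs.wordProd ω)⁻¹ = cs.simple i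
    · left
      rw [← ht]
      group
    · right
      exact ih (by simpa [ht] using h)

theorem inversionParity_eq_zero_of_length_lt {w : W} {i : B}
    (h : cs.length w < cs.length (w * cs.simple i)) :
    cs.inversionParity w (cs.simple i) = 0 := by
  by_contra hne
  obtain ⟨ω, hω, rfl⟩ := cs.exists_isReduced w
  have := cs.isRightInversion_of_mem_rightInvSeq hω
    (cs.mem_rightInvSeq_of_inversionParity_ne_zero ω _ hne)
  exact absurd this.2 h.not_gt

/-- The folding condition for Coxeter groups. -/
theorem simple_mul_eq_mul_simple {w : W} {i j : B}
    (hr : cs.length w < cs.length (w * cs.simple j))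
    (hlr : cs.length (cs.simple i * w * cs.simple j) < cs.length (cs.simple i * w)) :
    cs.simple i * w = w * cs.simple j := by
  classical
  have h₀ := cs.inversionParity_eq_zero_of_length_lt hr
  have h₁ : cs.inversionParity (cs.simple i * w * cs.simple j) (cs.simple j) = 0 :=
    cs.inversionParity_eq_zero_of_length_lt (by simpa using hlr)
  rw [inversionParity_mul_simple, inversionParity_simple_mul, h₀] at h₁
  by_cases h : w * cs.simple j * w⁻¹ = cs.simple i
  · rw [← h, inv_mul_cancel_right]
  · simp [h] at h₁

theorem simple_mul_mul_simple_eq_self {w : W} {i j : B}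
    (h : cs.length (cs.simple i * w) = cs.length (w * cs.simple j))
    (hlr : cs.length (cs.simple i * w * cs.simple j) = cs.length w) :
    cs.simple i * w * cs.simple j = w := by
  rcases cs.length_mul_simple w j with hr | hr
  · rw [cs.simple_mul_eq_mul_simple (i := i) (j := j) (by omega) (by omega)]
    simp
  · have := cs.simple_mul_eq_mul_simple (w := cs.simple i * w) (i := i) (j := j) (by omega)
      (by simpa using by omega)
    simpa using this.symm

theorem length_map_le (f : W →* W) (hf : ∀ i, f (cs.simple i) ∈ Set.range cs.simple) (w : W) :
    cs.length (f w) ≤ cs.length w := by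
  obtain ⟨ω, hω, rfl⟩ := cs.exists_isReduced w
  choose g hg using hf
  have : f (cs.wordProd ω) = cs.wordProd (ω.map g) := by
    simp [wordProd, map_list_prod, Function.comp_def, hg]
  rw [this, hω.eq]
  simpa using cs.length_wordProd_le (ω.map g)

end CoxeterSystem

namespace QuasiFlipTwinBuilding

variable {B : Type*} {W : Type*} [Group W] {M : CoxeterMatrix B} {cs : CoxeterSystem M W}
  {Cp : Type u} {Cm : Type v} (T : QuasiFlipTwinBuilding M cs Cp Cm)

theorem π_mem_range_simple {s : W} (hs : s ∈ Set.range cs.simple) :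
    T.π s ∈ Set.range cs.simple :=
  T.πS ▸ Set.mem_image_of_mem _ hs

theorem length_π (w : W) : cs.length (T.π w) = cs.length w := by
  have h (w : W) : cs.length (T.π w) ≤ cs.length w :=
    cs.length_map_le T.π.toMonoidHom (fun i => T.π_mem_range_simple ⟨i, rfl⟩) w
  exact (h w).antisymm (by simpa [T.ππ] using h (T.π w))

theorem δm_symm_of_simple {y z : Cm} {j : B} (h : T.δm y z = cs.simple j) :
    T.δm z y = cs.simple j := by
  have hz : T.δm z z = 1 := (T.m_eq_one_iff z z).2 rfl
  rcases T.m_two z y z _ ⟨j, rfl⟩ h with h' | h'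
  · obtain rfl := (T.m_eq_one_iff z y).1 (h' ▸ hz)
    rw [hz] at h
    rw [h', hz, h]
  · rw [hz] at h'
    rw [← cs.inv_simple j]
    exact eq_inv_of_mul_eq_one_left h'.symm

theorem δst_eq_or_eq_mul (x : Cp) {y z : Cm} {j : B} (h : T.δm y z = cs.simple j) :
    T.δst x z = T.δst x y ∨ T.δst x z = T.δst x y * cs.simple j := by
  rcases cs.length_mul_simple (T.δst x y) j with hl | hl
  · obtain ⟨u, hu, hxu⟩ := T.tw3p x y _ ⟨j, rfl⟩
    rcases T.m_two u y z _ ⟨j, rfl⟩ h with h' | h'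
    · left
      rw [T.δm_symm_of_simple hu] at h'
      rw [T.tw2p x u z _ ⟨j, rfl⟩ h' (by simp [hxu, hl]), hxu]
      simp
    · right
      rw [T.δm_symm_of_simple hu, cs.simple_mul_simple_self] at h'
      rw [← (T.m_eq_one_iff u z).1 h', hxu]
  · exact .inr (T.tw2p x y z _ ⟨j, rfl⟩ h hl)

theorem π_δθ (c : Cp) : T.π (T.δθ c) = (T.δθ c)⁻¹ := by
  have := T.flip_st c (T.θp c)
  rw [T.θmθp, T.tw1] at this
  exact this.symm

theorem length_simple_mul_δθ (c : Cp) {i j : B} (h : T.π (cs.simple i) = cs.simple j) :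
    cs.length (cs.simple i * T.δθ c) = cs.length (T.δθ c * cs.simple j) := by
  rw [← T.length_π, map_mul, h, π_δθ, ← cs.length_inv]
  simp

end QuasiFlipTwinBuilding

open QuasiFlipTwinBuilding in
/-- If two `s`-adjacent chambers (in the same half) of a twin building with a quasi-flip
`θ` have the same numerical `θ`-codistance, then they have the same `θ`-codistance. -/
theorem thetaCodistance_eq_of_adjacent_of_length_eq
    {B : Type*} {W : Type*} [Group W] {M : CoxeterMatrix B} {cs : CoxeterSystem M W}
    {Cp : Type u} {Cm : Type v} (T : QuasiFlipTwinBuilding M cs Cp Cm)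
    (c c' : Cp) (s : W) (hs : s ∈ Set.range cs.simple)
    (hadj : T.δp c c' = 1 ∨ T.δp c c' = s)
    (hl : T.ℓθ c = T.ℓθ c') :
    T.δθ c = T.δθ c' := by
  rcases hadj with hadj | hadj
  · rw [(T.p_eq_one_iff c c').1 hadj]
  obtain ⟨i, rfl⟩ := hs
  obtain ⟨j, hj⟩ := T.π_mem_range_simple ⟨i, rfl⟩
  have hm : T.δm (T.θp c) (T.θp c') = cs.simple j := by rw [T.flip_p, hadj, hj]
  have h₁ := T.δst_eq_or_eq_mul c hm
  have h₂ : T.δst c' (T.θp c') = T.δst c (T.θp c') ∨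
      T.δst c' (T.θp c') = cs.simple i * T.δst c (T.θp c') := by
    rcases T.swap.δst_eq_or_eq_mul (T.θp c') hadj with h | h
    · left
      simpa [swap, T.tw1] using h
    · right
      simpa [swap, T.tw1] using congrArg (·⁻¹) h
  change T.δst c (T.θp c') = T.δθ c ∨ T.δst c (T.θp c') = T.δθ c * cs.simple j at h₁
  change T.δθ c' = _ ∨ T.δθ c' = _ at h₂
  unfold ℓθ at hl
  rcases h₁ with h₁ | h₁ <;> rcases h₂ with h₂ | h₂ <;> rw [h₁] at h₂
  · exact h₂.symm
  · exact absurd (h₂ ▸ hl).symm (cs.length_simple_mul_ne _ i)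
  · exact absurd (h₂ ▸ hl).symm (cs.length_mul_simple_ne _ j)
  · rw [← mul_assoc] at h₂
    rw [h₂, cs.simple_mul_mul_simple_eq_self (T.length_simple_mul_δθ c hj.symm) (h₂ ▸ hl).symm]
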